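/- Let (C^1, …, C^k) be an admissible family in ℝ^n, let L(C^1,…,C^k) := L(C^1) + … + L(C^k), and let 𝒰 := {u ∈ L(C^1,…,C^k) \ {0} : F_{C^i}(u) ≠ ∅ for all i ∈ {1,…,k}}. Then the relative boundary of Q(C^1,…,C^k) equals (⋃_{u ∈ 𝒰} conv(⋃_{i=1}^k F_{C^i}(u) × {e^i})) ∪ (⋃_{i=1}^k {(x, y) ∈ Q(C^1,…,C^k) : y_i = 0}). -/

import Mathlib

open Pointwise Set

noncomputable section

/-- The recession cone of a set. -/
def recCone {E : Type*} [AddCommGroup E] [Module ℝ E] (S : Set E) : Set E :=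
  {d | ∀ x ∈ S, ∀ t : ℝ, 0 ≤ t → x + t • d ∈ S}

/-- An admissible family: each member is a nonempty closed convex set and all members share
the same recession cone. -/
def Admissible {n k : ℕ} (C : Fin k → Set (Fin n → ℝ)) : Prop :=
  (∀ i, (C i).Nonempty) ∧ (∀ i, IsClosed (C i)) ∧ (∀ i, Convex ℝ (C i)) ∧
    ∀ i j, recCone (C i) = recCone (C j)

/-- The Cayley embedding `Q(C¹,…,Cᵏ) = conv(⋃ᵢ Cⁱ × {eⁱ})`. -/
def CayleyQ {n k : ℕ} (C : Fin k → Set (Fin n → ℝ)) :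
    Set ((Fin n → ℝ) × (Fin k → ℝ)) :=
  convexHull ℝ (⋃ i, (C i) ×ˢ ({Pi.single i 1} : Set (Fin k → ℝ)))

def dotp {n : ℕ} (u x : Fin n → ℝ) : ℝ := ∑ j, u j * x j

/-- The support function of a set, with values in the extended reals. -/
def supportFn {n : ℕ} (S : Set (Fin n → ℝ)) (u : Fin n → ℝ) : EReal :=
  sSup ((fun x => ((dotp u x : ℝ) : EReal)) '' S)

/-- The face of `S` exposed by `u`. -/
def exposedFace {n : ℕ} (S : Set (Fin n → ℝ)) (u : Fin n → ℝ) : Set (Fin n → ℝ) :=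
  {x ∈ S | ((dotp u x : ℝ) : EReal) = supportFn S u}

section RelativeInterior

variable {E : Type*} [NormedAddCommGroup E] [NormedSpace ℝ E]

/-- A linear functional that attains its maximum over `S` at a point of the intrinsic interior
is constant on `S`. -/
theorem notMem_intrinsicInterior_of_linear_lt {S : Set E} (f : E →ₗ[ℝ] ℝ) {p q : E}
    (hmax : ∀ x ∈ S, f x ≤ f p) (hq : q ∈ S) (hlt : f q < f p) :
    p ∉ intrinsicInterior ℝ S := by
  rintro ⟨p', hp', rfl⟩
  let q' : affineSpan ℝ S := ⟨q, subset_affineSpan ℝ S hq⟩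
  have : Nonempty (affineSpan ℝ S) := ⟨q'⟩
  have hcont : Continuous fun t : ℝ => (AffineMap.lineMap q' p' t : affineSpan ℝ S) :=
    AffineMap.lineMap_continuous
  have hev : ∀ᶠ t in nhds (1 : ℝ),
      (AffineMap.lineMap q' p' t : affineSpan ℝ S) ∈ ((↑) ⁻¹' S : Set (affineSpan ℝ S)) := by
    refine hcont.continuousAt.eventually ?_
    simp only [AffineMap.lineMap_apply_one]
    exact mem_interior_iff_mem_nhds.mp hp'
  obtain ⟨t, htS, ht⟩ := ((hev.filter_mono nhdsWithin_le_nhds).and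
    (self_mem_nhdsWithin : Ioi (1 : ℝ) ∈ nhdsWithin 1 (Ioi 1))).exists
  have h := hmax _ htS
  have hcoe : ((AffineMap.lineMap q' p' t : affineSpan ℝ S) : E) = t • ((p' : E) - q) + q := rfl
  rw [hcoe, map_add, map_smul, map_sub, smul_eq_mul] at h
  have ht' : (1 : ℝ) < t := ht
  nlinarith

/-- Supporting hyperplane theorem for relative boundary points of a convex set: the supporting
functional can be chosen to be non-constant on the set. -/
theorem Convex.exists_linear_lt_of_notMem_intrinsicInterior [FiniteDimensional ℝ E] {S : Set E}
    (hS : Convex ℝ S) {p : E} (hp : p ∈ S) (hpi : p ∉ intrinsicInterior ℝ S) :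
    ∃ f : E →ₗ[ℝ] ℝ, (∀ x ∈ S, f x ≤ f p) ∧ ∃ q ∈ S, f q < f p := by
  let p' : affineSpan ℝ S := ⟨p, subset_affineSpan ℝ S hp⟩
  have : Nonempty (affineSpan ℝ S) := ⟨p'⟩
  let φ : (affineSpan ℝ S).direction ≃ₜ affineSpan ℝ S :=
    (AffineIsometryEquiv.vaddConst ℝ p').toHomeomorph
  have hφ : ∀ v, ((φ v : affineSpan ℝ S) : E) = (v : E) + p := fun v => rfl
  let T : Set (affineSpan ℝ S).direction := φ ⁻¹' ((↑) ⁻¹' S)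
  have hT : ∀ v, v ∈ T ↔ (v : E) + p ∈ S := fun v => Iff.rfl
  have hTi : interior T = φ ⁻¹' interior ((↑) ⁻¹' S) := (φ.preimage_interior _).symm
  have hTc : Convex ℝ T := by
    intro v hv w hw a b ha hb hab
    rw [hT] at *
    convert hS hv hw ha hb hab using 1
    simp only [Submodule.coe_add, Submodule.coe_smul, smul_add]
    nth_rewrite 1 [← one_smul ℝ p]
    rw [← hab, add_smul]
    abel
  have h0 : (0 : (affineSpan ℝ S).direction) ∉ interior T := by
    rw [hTi]
    intro h
    exact hpi ⟨φ 0, h, by rw [hφ]; simp⟩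
  obtain ⟨g, hg⟩ := geometric_hahn_banach_open_point hTc.interior isOpen_interior h0
  obtain ⟨f, hf⟩ := LinearMap.exists_extend (g : (affineSpan ℝ S).direction →ₗ[ℝ] ℝ)
  have hfg : ∀ v : (affineSpan ℝ S).direction, f v = g v := fun v => LinearMap.congr_fun hf v
  obtain ⟨q, q', hq', rfl⟩ := (intrinsicInterior_nonempty hS).mpr ⟨p, hp⟩
  have hmemT : ∀ x (hx : x ∈ S), ∃ v : (affineSpan ℝ S).direction, v ∈ T ∧ (v : E) = x - p := by
    intro x hx
    refine ⟨⟨x - p, AffineSubspace.vsub_mem_direction (subset_affineSpan ℝ S hx)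
      (subset_affineSpan ℝ S hp)⟩, ?_, rfl⟩
    rw [hT]
    simpa using hx
  have hqT : φ.symm q' ∈ interior T := by
    rw [hTi]
    simpa using hq'
  refine ⟨f, fun x hx => ?_, q',
    (interior_subset hq' : q' ∈ ((↑) ⁻¹' S : Set (affineSpan ℝ S))), ?_⟩
  · obtain ⟨v, hv, hvx⟩ := hmemT x hx
    have hcl : v ∈ closure (interior T) := by
      rw [hTc.closure_interior_eq_closure_of_nonempty_interior ⟨_, hqT⟩]
      exact subset_closure hv
    have hle : closure (interior T) ⊆ {v | g v ≤ g 0} :=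
      closure_minimal (fun v hv => (hg v hv).le) (isClosed_le g.continuous continuous_const)
    have h1 : g v ≤ g 0 := hle hcl
    rw [← hfg, hvx, map_zero, map_sub] at h1
    linarith
  · have h1 := hg _ hqT
    have h2 : (q' : E) = ((φ.symm q' : (affineSpan ℝ S).direction) : E) + p := by
      rw [← hφ, φ.apply_symm_apply]
    rw [h2, map_add, hfg]
    rw [map_zero] at h1
    linarith

end RelativeInterior

/-- If a linear functional is bounded on `A` by its value at `p ∈ conv A`, then `p` lies in the
convex hull of the points of `A` where this value is attained. -/
theorem mem_convexHull_sep_of_linear_le {E : Type*} [AddCommGroup E] [Module ℝ E] {A : Set E}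
    (f : E →ₗ[ℝ] ℝ) {p : E} (hp : p ∈ convexHull ℝ A) (hmax : ∀ x ∈ A, f x ≤ f p) :
    p ∈ convexHull ℝ {x ∈ A | f x = f p} := by
  have hconv : Convex ℝ {x | f x < f p ∨ (f x = f p ∧ x ∈ convexHull ℝ {x ∈ A | f x = f p})} := by
    refine convex_iff_forall_pos.mpr fun x hx y hy a b ha hb hab => ?_
    simp only [mem_ofPred_eq, map_add, map_smul, smul_eq_mul] at hx hy ⊢
    have hb' : b = 1 - a := by linarith
    rcases hx with hx | ⟨hx, hx'⟩
    · left
      have hy' : f y ≤ f p := by rcases hy with h | h <;> linarith [h]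
      subst hb'
      nlinarith
    · rcases hy with hy | ⟨hy, hy'⟩
      · left
        subst hb'
        nlinarith
      · right
        refine ⟨?_, convex_convexHull ℝ _ hx' hy' ha.le hb.le hab⟩
        rw [hx, hy, ← add_mul, hab, one_mul]
  have hsub : A ⊆ {x | f x < f p ∨ (f x = f p ∧ x ∈ convexHull ℝ {x ∈ A | f x = f p})} := by
    intro x hx
    rcases (hmax x hx).lt_or_eq with h | h
    · exact Or.inl h
    · exact Or.inr ⟨h, subset_convexHull ℝ _ ⟨hx, h⟩⟩
  rcases convexHull_min hsub hconv hp with h | h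
  · exact absurd h (lt_irrefl _)
  · exact h.2

/-- `dotp u` as a linear map. -/
def dotpLin {n : ℕ} (u : Fin n → ℝ) : (Fin n → ℝ) →ₗ[ℝ] ℝ where
  toFun := dotp u
  map_add' x y := dotProduct_add u x y
  map_smul' c x := dotProduct_smul c u x

@[simp]
theorem dotpLin_apply {n : ℕ} (u x : Fin n → ℝ) : dotpLin u x = dotp u x := rfl

theorem exists_dotp_eq {n : ℕ} (g : (Fin n → ℝ) →ₗ[ℝ] ℝ) : ∃ u, ∀ x, g x = dotp u x := by
  refine ⟨fun j => g (Pi.single j 1), fun x => ?_⟩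
  rw [LinearMap.pi_apply_eq_sum_univ g x, dotp]
  refine Finset.sum_congr rfl fun j _ => ?_
  rw [smul_eq_mul, mul_comm]
  congr 2
  ext i
  simp [Pi.single_apply, eq_comm]

theorem dotp_self_ne_zero {n : ℕ} {u : Fin n → ℝ} (hu : u ≠ 0) : dotp u u ≠ 0 :=
  fun h => hu (dotProduct_self_eq_zero.mp h)

/-- Every linear functional is represented on a subspace `L` by an element of `L`. -/
theorem exists_mem_dotp_eq_on {n : ℕ} (L : Submodule ℝ (Fin n → ℝ)) (u : Fin n → ℝ) :
    ∃ v ∈ L, ∀ x ∈ L, dotp v x = dotp u x := by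
  let e := WithLp.linearEquiv 2 ℝ (Fin n → ℝ)
  let M : Submodule ℝ (EuclideanSpace ℝ (Fin n)) := L.comap e.toLinearMap
  have hinner : ∀ a b : EuclideanSpace ℝ (Fin n), dotp (e a) (e b) = inner ℝ a b := by
    intro a b
    simp [dotp, e, PiLp.inner_apply, mul_comm]
  let w : EuclideanSpace ℝ (Fin n) := e.symm u
  refine ⟨e (M.starProjection w), M.starProjection_apply_mem w, fun x hx => ?_⟩
  have hxM : e.symm x ∈ M := by simpa [M] using hx
  have h := M.starProjection_inner_eq_zero w (e.symm x) hxM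
  rw [inner_sub_left, ← hinner, ← hinner] at h
  simp only [w, LinearEquiv.apply_symm_apply] at h
  linarith

theorem mem_exposedFace_iff {n : ℕ} {S : Set (Fin n → ℝ)} {u x : Fin n → ℝ} :
    x ∈ exposedFace S u ↔ x ∈ S ∧ ∀ y ∈ S, dotp u y ≤ dotp u x := by
  refine and_congr_right fun hx => ⟨fun h y hy => ?_, fun h => le_antisymm ?_ ?_⟩
  · rw [← EReal.coe_le_coe_iff, h]
    exact le_sSup ⟨y, hy, rfl⟩
  · exact le_sSup ⟨x, hx, rfl⟩
  · refine sSup_le ?_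
    rintro _ ⟨y, hy, rfl⟩
    exact EReal.coe_le_coe_iff.mpr (h y hy)

section Cayley

variable {n k : ℕ} {C : Fin k → Set (Fin n → ℝ)}

theorem mem_cayleyQ_of_mem {i : Fin k} {x : Fin n → ℝ} (hx : x ∈ C i) :
    (x, Pi.single i 1) ∈ CayleyQ C :=
  subset_convexHull ℝ _ (mem_iUnion.mpr ⟨i, hx, rfl⟩)

theorem le_of_mem_cayleyQ (f : ((Fin n → ℝ) × (Fin k → ℝ)) →ₗ[ℝ] ℝ) {c : ℝ}
    (h : ∀ i, ∀ x ∈ C i, f (x, Pi.single i 1) ≤ c) {p : (Fin n → ℝ) × (Fin k → ℝ)}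
    (hp : p ∈ CayleyQ C) : f p ≤ c := by
  refine convexHull_min (t := {p | f p ≤ c}) ?_ (convex_halfSpace_le f.isLinear c) hp
  rintro ⟨x, y⟩ hxy
  obtain ⟨i, hx, rfl⟩ := mem_iUnion.mp hxy
  exact h i x hx

theorem sub_mem_iSup_direction {i : Fin k} {x y : Fin n → ℝ} (hx : x ∈ C i) (hy : y ∈ C i) :
    x - y ∈ (⨆ i, (affineSpan ℝ (C i)).direction : Submodule ℝ (Fin n → ℝ)) :=
  Submodule.mem_iSup_of_mem i
    (AffineSubspace.vsub_mem_direction (mem_affineSpan ℝ hx) (mem_affineSpan ℝ hy))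

/-- A direction `u ≠ 0` in `L(C¹,…,Cᵏ)` is non-constant on some `Cⁱ`. -/
theorem exists_dotp_ne {u : Fin n → ℝ}
    (hu : u ∈ (⨆ i, (affineSpan ℝ (C i)).direction : Submodule ℝ (Fin n → ℝ))) (hu0 : u ≠ 0) :
    ∃ i, ∃ x ∈ C i, ∃ y ∈ C i, dotp u x ≠ dotp u y := by
  by_contra! h
  refine dotp_self_ne_zero hu0 ?_
  have hle : (⨆ i, (affineSpan ℝ (C i)).direction) ≤ LinearMap.ker (dotpLin u) := by
    refine iSup_le fun i => ?_
    rw [direction_affineSpan, vectorSpan, Submodule.span_le]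
    rintro _ ⟨x, hx, y, hy, rfl⟩
    have h1 : dotpLin u x = dotpLin u y := h i x hx y hy
    simp only [vsub_eq_sub, SetLike.mem_coe, LinearMap.mem_ker, map_sub, h1, sub_self]
  exact hle hu

theorem notMem_intrinsicInterior_of_coord_eq_zero (hne : ∀ i, (C i).Nonempty)
    {p : (Fin n → ℝ) × (Fin k → ℝ)} {i : Fin k} (hi : p.2 i = 0) :
    p ∉ intrinsicInterior ℝ (CayleyQ C) := by
  obtain ⟨x, hx⟩ := hne i
  let f : ((Fin n → ℝ) × (Fin k → ℝ)) →ₗ[ℝ] ℝ := -(LinearMap.proj i ∘ₗ LinearMap.snd ℝ _ _)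
  have hf : ∀ q, f q = -q.2 i := fun q => rfl
  refine notMem_intrinsicInterior_of_linear_lt f (fun q hq => le_of_mem_cayleyQ f ?_ hq)
    (mem_cayleyQ_of_mem hx) ?_
  · intro j y _
    rw [hf, hf, hi]
    by_cases hij : i = j <;> simp [hij]
  · rw [hf, hf, hi]
    simp

theorem notMem_intrinsicInterior_of_mem_convexHull_exposedFace {u : Fin n → ℝ}
    (hu : u ∈ (⨆ i, (affineSpan ℝ (C i)).direction : Submodule ℝ (Fin n → ℝ))) (hu0 : u ≠ 0)
    (hF : ∀ i, (exposedFace (C i) u).Nonempty) {p : (Fin n → ℝ) × (Fin k → ℝ)}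
    (hp : p ∈ CayleyQ fun i => exposedFace (C i) u) :
    p ∉ intrinsicInterior ℝ (CayleyQ C) := by
  choose z hz using hF
  let f : ((Fin n → ℝ) × (Fin k → ℝ)) →ₗ[ℝ] ℝ :=
    (dotpLin u).coprod (-dotpLin fun i => dotp u (z i))
  have hf : ∀ i x, f (x, Pi.single i 1) = dotp u x - dotp u (z i) := by
    intro i x
    simp [f, sub_eq_add_neg, dotp, Pi.single_apply]
  have hmax : ∀ i, ∀ x ∈ C i, f (x, Pi.single i 1) ≤ 0 := by
    intro i x hx
    rw [hf]
    linarith [(mem_exposedFace_iff.mp (hz i)).2 x hx]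
  have hp0 : 0 ≤ f p := by
    have h : (-f) p ≤ 0 := by
      refine le_of_mem_cayleyQ (-f) (fun i x hx => ?_) hp
      rw [LinearMap.neg_apply, hf]
      linarith [(mem_exposedFace_iff.mp hx).2 (z i) (hz i).1]
    rw [LinearMap.neg_apply] at h
    linarith
  have hlt : ∃ i, ∃ x ∈ C i, f (x, Pi.single i 1) < 0 := by
    by_contra! h
    obtain ⟨i, x, hx, y, hy, hxy⟩ := exists_dotp_ne hu hu0
    have h1 := le_antisymm (hmax i x hx) (h i x hx)
    have h2 := le_antisymm (hmax i y hy) (h i y hy)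
    rw [hf] at h1 h2
    exact hxy (by linarith)
  obtain ⟨i, x, hx, hxlt⟩ := hlt
  exact notMem_intrinsicInterior_of_linear_lt f
    (fun q hq => (le_of_mem_cayleyQ f hmax hq).trans hp0) (mem_cayleyQ_of_mem hx)
    (hxlt.trans_le hp0)

theorem exists_mem_convexHull_exposedFace {p : (Fin n → ℝ) × (Fin k → ℝ)}
    (hp : p ∈ CayleyQ C) (hpi : p ∉ intrinsicInterior ℝ (CayleyQ C)) (hp0 : ∀ i, p.2 i ≠ 0) :
    ∃ u ∈ (⨆ i, (affineSpan ℝ (C i)).direction : Submodule ℝ (Fin n → ℝ)), u ≠ 0 ∧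
      (∀ i, (exposedFace (C i) u).Nonempty) ∧ p ∈ CayleyQ fun i => exposedFace (C i) u := by
  obtain ⟨f, hmax, q, hq, hlt⟩ :=
    (convex_convexHull ℝ _).exists_linear_lt_of_notMem_intrinsicInterior hp hpi
  obtain ⟨w, hw⟩ := exists_dotp_eq (f ∘ₗ LinearMap.inl ℝ _ _)
  obtain ⟨u, huL, hu⟩ := exists_mem_dotp_eq_on (⨆ i, (affineSpan ℝ (C i)).direction) w
  have hdiff : ∀ i, ∀ x ∈ C i, ∀ y ∈ C i,
      f (x, Pi.single i 1) - f (y, Pi.single i 1) = dotp u x - dotp u y := by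
    intro i x hx y hy
    have h1 : dotpLin u (x - y) = f (x - y, 0) :=
      (hu _ (sub_mem_iSup_direction hx hy)).trans (hw _).symm
    rw [← map_sub, Prod.mk_sub_mk, sub_self, ← h1, map_sub]
    rfl
  have hface := mem_convexHull_sep_of_linear_le f hp fun x hx => hmax x (subset_convexHull ℝ _ hx)
  have hpF : p ∈ CayleyQ fun i => exposedFace (C i) u := by
    refine convexHull_mono ?_ hface
    rintro ⟨x, y⟩ ⟨hxy, hfx⟩
    obtain ⟨i, hx, rfl⟩ := mem_iUnion.mp hxy
    refine mem_iUnion.mpr ⟨i, mem_exposedFace_iff.mpr ⟨hx, fun z hz => ?_⟩, rfl⟩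
    have h1 := hdiff i z hz x hx
    have h2 := hmax _ (mem_cayleyQ_of_mem hz)
    linarith
  have hF : ∀ i, (exposedFace (C i) u).Nonempty := by
    intro i
    by_contra hempty
    refine hp0 i ?_
    refine convexHull_min (t := {p : (Fin n → ℝ) × (Fin k → ℝ) | p.2 i = 0}) ?_ ?_ hpF
    · rintro ⟨x, y⟩ hxy
      obtain ⟨j, hx, rfl⟩ := mem_iUnion.mp hxy
      have hij : i ≠ j := by
        rintro rfl
        exact hempty ⟨x, hx⟩
      simp [hij]
    · exact convex_hyperplane
        (LinearMap.proj i ∘ₗ LinearMap.snd ℝ (Fin n → ℝ) (Fin k → ℝ)).isLinear 0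
  refine ⟨u, huL, ?_, hF, hpF⟩
  rintro rfl
  have hz : ∀ x : Fin n → ℝ, dotp 0 x = 0 := zero_dotProduct
  have hconst : ∀ i, ∀ x ∈ C i, f p ≤ f (x, Pi.single i 1) := by
    intro i x hx
    by_contra! hxlt
    refine hp0 i ?_
    refine convexHull_min (t := {p : (Fin n → ℝ) × (Fin k → ℝ) | p.2 i = 0}) ?_ ?_ hface
    · rintro ⟨y, s⟩ ⟨hys, hfy⟩
      obtain ⟨j, hy, rfl⟩ := mem_iUnion.mp hys
      have hij : i ≠ j := by
        rintro rfl
        have := hdiff i x hx y hy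
        rw [hz, hz] at this
        linarith
      simp [hij]
    · exact convex_hyperplane
        (LinearMap.proj i ∘ₗ LinearMap.snd ℝ (Fin n → ℝ) (Fin k → ℝ)).isLinear 0
  have h : (-f) q ≤ -f p := by
    refine le_of_mem_cayleyQ (-f) (fun i x hx => ?_) hq
    rw [LinearMap.neg_apply]
    linarith [hconst i x hx]
  rw [LinearMap.neg_apply] at h
  linarith

end Cayley

/-- The boundary structure of the Cayley embedding: the relative boundary of `Q(C¹,…,Cᵏ)`
(its set difference with its intrinsic interior) is the union of the faces generated by
common exposing directions in `L(C¹,…,Cᵏ) ∖ {0}` together with the slices `{yᵢ = 0}`. -/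
theorem stmt11 {n k : ℕ} (C : Fin k → Set (Fin n → ℝ)) (hC : Admissible C) :
    CayleyQ C \ intrinsicInterior ℝ (CayleyQ C) =
      (⋃ u ∈ {u : Fin n → ℝ |
          u ∈ (⨆ i, (affineSpan ℝ (C i)).direction : Submodule ℝ (Fin n → ℝ)) ∧
          u ≠ 0 ∧ ∀ i, (exposedFace (C i) u).Nonempty},
        convexHull ℝ (⋃ i, (exposedFace (C i) u) ×ˢ ({Pi.single i 1} : Set (Fin k → ℝ)))) ∪
      (⋃ i, {p ∈ CayleyQ C | p.2 i = 0}) := by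
  ext p
  constructor
  · rintro ⟨hp, hpi⟩
    by_cases h0 : ∃ i, p.2 i = 0
    · obtain ⟨i, hi⟩ := h0
      exact Or.inr (mem_iUnion.mpr ⟨i, hp, hi⟩)
    · push Not at h0
      obtain ⟨u, huL, hu0, hF, hpF⟩ := exists_mem_convexHull_exposedFace hp hpi h0
      exact Or.inl (mem_biUnion ⟨huL, hu0, hF⟩ hpF)
  · rintro (h | h)
    · obtain ⟨u, ⟨huL, hu0, hF⟩, hpF⟩ := mem_iUnion₂.mp h
      exact ⟨convexHull_mono (iUnion_mono fun i => prod_mono_left fun x hx => hx.1) hpF,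
        notMem_intrinsicInterior_of_mem_convexHull_exposedFace huL hu0 hF hpF⟩
    · obtain ⟨i, hp, hi⟩ := mem_iUnion.mp h
      exact ⟨hp, notMem_intrinsicInterior_of_coord_eq_zero hC.1 hi⟩
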